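/- Let n ≥ 2, q a nonzero real number, and let 𝔤 be a 2n-dimensional real Lie algebra with complex structure J admitting a basis α₁,…,α_n of (𝔤^{1,0})* with dα_k = 0 for 1 ≤ k ≤ n−1 and dα_n = q α₁ ∧ ᾱ₁. Then the positive (1,1)-form ω = i Σ_{j=1}^n α_j ∧ ᾱ_j satisfies both ddᶜω = 0 (ω is pluriclosed) and d(ω^{n−1}) = θ ∧ ω^{n−1} with θ = q(α_n + ᾱ_n) and dθ = 0 (ω is locally conformally balanced). -/

import Mathlib

open scoped BigOperators

/-- The strictly increasing enumeration of `Fin N` avoiding the two indices `a < b`. -/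
def skipTwo {N : ℕ} (a b : ℕ) (t : Fin (N - 2)) : Fin N :=
  ⟨if (t : ℕ) < a then (t : ℕ) else if (t : ℕ) + 1 < b then (t : ℕ) + 1 else (t : ℕ) + 2,
    by have := t.isLt; split_ifs <;> omega⟩

/-- The Chevalley–Eilenberg differential of a (raw) `p`-form on a Lie algebra. -/
noncomputable def ceD {g : Type} [LieRing g] [LieAlgebra ℝ g] {p : ℕ}
    (η : (Fin p → g) → ℂ) : (Fin (p + 1) → g) → ℂ :=
  fun X => ∑ i : Fin (p + 1), ∑ j : Fin (p + 1),
    if hij : (i : ℕ) < (j : ℕ) then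
      (-1 : ℂ) ^ ((i : ℕ) + (j : ℕ)) *
        η (fun t => if ht : (t : ℕ) = 0 then ⁅X i, X j⁆
            else X (skipTwo (N := p + 1) (i : ℕ) (j : ℕ)
              ⟨(t : ℕ) - 1, by have := t.isLt; omega⟩))
    else 0

/-- The wedge product of a (raw) `p`-form and a (raw) `q`-form. -/
noncomputable def wedge {g : Type} [LieRing g] [LieAlgebra ℝ g] {p q : ℕ}
    (α : (Fin p → g) → ℂ) (β : (Fin q → g) → ℂ) : (Fin (p + q) → g) → ℂ :=
  fun X => ((p.factorial : ℂ) * (q.factorial : ℂ))⁻¹ *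
    ∑ σ : Equiv.Perm (Fin (p + q)),
      ((Equiv.Perm.sign σ : ℤ) : ℂ) *
        α (fun i => X (σ (Fin.castAdd q i))) * β (fun i => X (σ (Fin.natAdd p i)))

/-- The `k`-th wedge power of a (raw) `2`-form. -/
noncomputable def wpow {g : Type} [LieRing g] [LieAlgebra ℝ g]
    (ω : (Fin 2 → g) → ℂ) (k : ℕ) : (Fin (2 * k) → g) → ℂ :=
  fun X => ((2 : ℂ) ^ k)⁻¹ *
    ∑ σ : Equiv.Perm (Fin (2 * k)),
      ((Equiv.Perm.sign σ : ℤ) : ℂ) *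
        ∏ t : Fin k, ω (fun s => X (σ ⟨2 * (t : ℕ) + (s : ℕ),
          by have := t.isLt; have := s.isLt; omega⟩))

/-- The action of (the linear extension of) `J` on (raw) `p`-forms:
`(Jη)(X₁, …, X_p) = (−1)^p η(JX₁, …, JX_p)`. -/
noncomputable def Jact {g : Type} [LieRing g] [LieAlgebra ℝ g] (J : g →ₗ[ℝ] g) {p : ℕ}
    (η : (Fin p → g) → ℂ) : (Fin p → g) → ℂ :=
  fun X => (-1 : ℂ) ^ p * η (fun i => J (X i))

/-- The operator `dᶜ = −J⁻¹ d J` on (raw) `p`-forms, where `J⁻¹ = (−1)^p J` on `p`-forms. -/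
noncomputable def dcD {g : Type} [LieRing g] [LieAlgebra ℝ g] (J : g →ₗ[ℝ] g) {p : ℕ}
    (η : (Fin p → g) → ℂ) : (Fin (p + 1) → g) → ℂ :=
  fun X => (-1 : ℂ) ^ p * Jact J (ceD (Jact J η)) X

/-- A linear functional viewed as a raw `1`-form. -/
def oneF {g : Type} [LieRing g] [LieAlgebra ℝ g] (f : g → ℂ) : (Fin 1 → g) → ℂ :=
  fun X => f (X 0)

/-- Reindexing a raw `a`-form as a `b`-form along a proof `a = b`. -/
def reind {g : Type} [LieRing g] [LieAlgebra ℝ g] {a b : ℕ} (h : a = b)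
    (η : (Fin a → g) → ℂ) : (Fin b → g) → ℂ :=
  fun X => η (fun i => X (Fin.cast h i))

/-- The wedge product of a family of `p` raw `1`-forms. -/
noncomputable def wedgeList {g : Type} [LieRing g] [LieAlgebra ℝ g] {p : ℕ}
    (f : Fin p → g → ℂ) : (Fin p → g) → ℂ :=
  fun X => ∑ σ : Equiv.Perm (Fin p), ((Equiv.Perm.sign σ : ℤ) : ℂ) * ∏ t, f t (X (σ t))

/-- The full coframe `α₁, ᾱ₁, …, α_n, ᾱ_n` as a list of `2n` raw `1`-forms. -/
noncomputable def coframeList {g : Type} [LieRing g] [LieAlgebra ℝ g] (n : ℕ)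
    (α : Fin n → (g →ₗ[ℝ] ℂ)) : Fin (2 * n) → g → ℂ :=
  fun t x =>
    if (t : ℕ) % 2 = 0 then α ⟨(t : ℕ) / 2, by have := t.isLt; omega⟩ x
    else (starRingEnd ℂ) (α ⟨(t : ℕ) / 2, by have := t.isLt; omega⟩ x)

/-- The `(n−1, n−1)`-form `m_{i j̄}`: the wedge `α₁ ∧ ᾱ₁ ∧ … ∧ α_n ∧ ᾱ_n` with
`α_i` and `ᾱ_j` deleted. -/
noncomputable def mForm {g : Type} [LieRing g] [LieAlgebra ℝ g] (n : ℕ)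
    (α : Fin n → (g →ₗ[ℝ] ℂ)) (i j : Fin n) : (Fin (2 * n - 2) → g) → ℂ :=
  fun X => wedgeList (fun t =>
    coframeList n α
      (if 2 * (i : ℕ) < 2 * (j : ℕ) + 1
        then skipTwo (N := 2 * n) (2 * (i : ℕ)) (2 * (j : ℕ) + 1) t
        else skipTwo (N := 2 * n) (2 * (j : ℕ) + 1) (2 * (i : ℕ)) t)) X

section WedgeOfOneForms

variable {g : Type} [LieRing g] [LieAlgebra ℝ g]

theorem wedgeList_eq_det {p : ℕ} (c : Fin p → g → ℂ) (X : Fin p → g) :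
    wedgeList c X = (Matrix.of fun i t => c t (X i)).det := by
  simp [wedgeList, Matrix.det_apply']

theorem wedgeList_cons {p : ℕ} (u : g → ℂ) (c : Fin p → g → ℂ) (X : Fin (p + 1) → g) :
    wedgeList (Fin.cons u c : Fin (p + 1) → g → ℂ) X =
      ∑ i : Fin (p + 1), (-1) ^ (i : ℕ) * u (X i) * wedgeList c (X ∘ i.succAbove) := by
  rw [wedgeList_eq_det, Matrix.det_succ_column_zero]
  refine Finset.sum_congr rfl fun i _ => ?_
  rw [wedgeList_eq_det]
  rfl

theorem wedgeList_comp_perm {p : ℕ} (c : Fin p → g → ℂ) (σ : Equiv.Perm (Fin p))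
    (X : Fin p → g) :
    wedgeList (c ∘ σ) X = ((Equiv.Perm.sign σ : ℤ) : ℂ) * wedgeList c X := by
  rw [wedgeList_eq_det, wedgeList_eq_det, ← Matrix.det_permute']
  rfl

theorem wedgeList_eq_zero_of_eq_smul {p : ℕ} (c : Fin p → g → ℂ) {s t : Fin p} (hst : s ≠ t)
    (z : ℂ) (h : ∀ x, c s x = z * c t x) (X : Fin p → g) : wedgeList c X = 0 := by
  rw [wedgeList_eq_det]
  set A : Matrix (Fin p) (Fin p) ℂ := Matrix.of fun i t => c t (X i) with hA
  have h1 : A = A.updateCol s (z • fun i => A i t) := by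
    ext i j
    by_cases hj : j = s
    · subst hj
      simp [hA, h]
    · simp [Matrix.updateCol_ne hj]
  rw [h1, Matrix.det_updateCol_smul]
  rw [Matrix.det_zero_of_column_eq hst, mul_zero]
  intro i
  simp [Matrix.updateCol_ne hst.symm]

theorem wedgeList_cons_add_smul {p : ℕ} (z w : ℂ) (u v : g → ℂ) (c : Fin p → g → ℂ)
    (X : Fin (p + 1) → g) :
    wedgeList (Fin.cons (fun x => z * u x + w * v x) c : Fin (p + 1) → g → ℂ) X =
      z * wedgeList (Fin.cons u c : Fin (p + 1) → g → ℂ) X +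
      w * wedgeList (Fin.cons v c : Fin (p + 1) → g → ℂ) X := by
  simp only [wedgeList_cons, Finset.mul_sum, ← Finset.sum_add_distrib]
  exact Finset.sum_congr rfl fun i _ => by ring

theorem wedgeList_cons_smul {p : ℕ} (z : ℂ) (u : g → ℂ) (c : Fin p → g → ℂ)
    (X : Fin (p + 1) → g) :
    wedgeList (Fin.cons (fun x => z * u x) c : Fin (p + 1) → g → ℂ) X =
      z * wedgeList (Fin.cons u c : Fin (p + 1) → g → ℂ) X := by
  simpa using wedgeList_cons_add_smul z 0 u u c X

/-- Interior product of a vector which only the first two factors detect. -/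
theorem wedgeList_cons_cons_apply_cons {p : ℕ} (u v : g → ℂ) (c : Fin p → g → ℂ) (z : g)
    (hz : ∀ t, c t z = 0) (Y : Fin (p + 1) → g) :
    wedgeList (Fin.cons u (Fin.cons v c : Fin (p + 1) → g → ℂ) : Fin (p + 2) → g → ℂ)
        (Fin.cons z Y : Fin (p + 2) → g) =
      u z * wedgeList (Fin.cons v c : Fin (p + 1) → g → ℂ) Y -
      v z * wedgeList (Fin.cons u c : Fin (p + 1) → g → ℂ) Y := by
  rw [wedgeList_eq_det, Matrix.det_succ_row_zero, Fin.sum_univ_succ, Fin.sum_univ_succ]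
  simp only [wedgeList_eq_det]
  rw [Finset.sum_eq_zero]
  · have h1 : (Matrix.of fun i t => (Fin.cons u (Fin.cons v c : Fin (p + 1) → g → ℂ) :
        Fin (p + 2) → g → ℂ) t ((Fin.cons z Y : Fin (p + 2) → g) i)).submatrix Fin.succ
          (Fin.succ 0 : Fin (p + 2)).succAbove =
        Matrix.of fun i t => (Fin.cons u c : Fin (p + 1) → g → ℂ) t (Y i) := by
      ext i t
      refine Fin.cases ?_ (fun t => ?_) t <;> simp
    rw [h1]
    have h0 : (Matrix.of fun i t => (Fin.cons u (Fin.cons v c : Fin (p + 1) → g → ℂ) :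
        Fin (p + 2) → g → ℂ) t ((Fin.cons z Y : Fin (p + 2) → g) i)).submatrix Fin.succ
          (0 : Fin (p + 2)).succAbove =
        Matrix.of fun i t => (Fin.cons v c : Fin (p + 1) → g → ℂ) t (Y i) := by
      ext i t
      simp
    rw [h0]
    simp
    ring
  · intro t _
    simp [hz]

theorem sum_sum_succAbove {p : ℕ} (G : Fin (p + 2) → Fin (p + 1) → ℂ) :
    ∑ i, ∑ j, G i j = ∑ i : Fin (p + 2), ∑ j : Fin (p + 2),
      if hij : (i : ℕ) < j then G i ⟨j - 1, by omega⟩ + G j ⟨i, by omega⟩ else 0 := by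
  have h (i : Fin (p + 2)) : ∑ j, G i j = ∑ j : Fin (p + 2),
      ((if hij : (i : ℕ) < j then G i ⟨j - 1, by omega⟩ else 0) +
        (if hij : (j : ℕ) < i then G i ⟨j, by omega⟩ else 0)) := by
    rw [Fin.sum_univ_succAbove _ i]
    simp only [lt_irrefl, dite_false, add_zero, zero_add]
    refine Finset.sum_congr rfl fun j _ => ?_
    by_cases hj : (j : ℕ) < i
    · have : (i.succAbove j : ℕ) = j := by
        rw [Fin.succAbove_of_castSucc_lt _ _ (by simpa [Fin.lt_def] using hj)]; simp
      simp [this, hj, hj.le]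
    · have : (i.succAbove j : ℕ) = j + 1 := by
        rw [Fin.succAbove_of_le_castSucc _ _ (by simpa [Fin.le_def] using hj)]; simp
      have h2 : (i : ℕ) < j + 1 := by omega
      have h3 : ¬ ((j : ℕ) + 1 < i) := by omega
      simp [this, h2, h3]
  simp only [h, Finset.sum_add_distrib]
  rw [Finset.sum_comm (f := fun i j : Fin (p + 2) =>
    (if hij : (j : ℕ) < i then G i ⟨j, by omega⟩ else 0))]
  simp only [← Finset.sum_add_distrib]
  refine Finset.sum_congr rfl fun i _ => Finset.sum_congr rfl fun j _ => ?_
  split_ifs <;> simp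

/-- Laplace expansion along the first two factors. -/
theorem wedgeList_cons_cons {p : ℕ} (u v : g → ℂ) (c : Fin p → g → ℂ) (X : Fin (p + 2) → g) :
    wedgeList (Fin.cons u (Fin.cons v c : Fin (p + 1) → g → ℂ) : Fin (p + 2) → g → ℂ) X =
      ∑ i : Fin (p + 2), ∑ j : Fin (p + 2), if (i : ℕ) < j then
        (-1) ^ ((i : ℕ) + j) * (-(u (X i) * v (X j) - u (X j) * v (X i))) *
          wedgeList c (fun t : Fin p => X (skipTwo (N := p + 2) i j t)) else 0 := by
  rw [wedgeList_cons]
  simp only [wedgeList_cons, Finset.mul_sum]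
  rw [sum_sum_succAbove]
  refine Finset.sum_congr rfl fun i _ => Finset.sum_congr rfl fun j _ => ?_
  split_ifs with hij
  · have e1 : i.succAbove ⟨j - 1, by omega⟩ = j := by
      ext
      rw [Fin.succAbove_of_le_castSucc _ _ (by rw [Fin.le_def]; simp only [Fin.val_castSucc]; omega)]
      simp; omega
    have e2 : j.succAbove ⟨i, by omega⟩ = i := by
      ext
      rw [Fin.succAbove_of_castSucc_lt _ _ (by rw [Fin.lt_def]; exact hij)]
      simp
    have s1 : (X ∘ i.succAbove) ∘ (⟨j - 1, by omega⟩ : Fin (p + 1)).succAbove =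
        fun t : Fin p => X (skipTwo (N := p + 2) i j t) := by
      funext t
      simp only [Function.comp]
      congr 1
      ext
      simp only [Fin.succAbove, skipTwo, Fin.lt_def, Fin.val_castSucc]
      split_ifs <;> simp_all <;> omega
    have s2 : (X ∘ j.succAbove) ∘ (⟨i, by omega⟩ : Fin (p + 1)).succAbove =
        fun t : Fin p => X (skipTwo (N := p + 2) i j t) := by
      funext t
      simp only [Function.comp]
      congr 1
      ext
      simp only [Fin.succAbove, skipTwo, Fin.lt_def, Fin.val_castSucc]
      split_ifs <;> simp_all; omega
    rw [s1, s2]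
    simp only [Function.comp, e1, e2]
    obtain ⟨k, hk⟩ : ∃ k, (j : ℕ) = k + 1 := ⟨j - 1, by omega⟩
    generalize wedgeList c _ = W
    simp only [hk, Nat.add_sub_cancel, pow_add, pow_one]
    ring
  · rfl

theorem wedgeList_cons_cons_swap {p : ℕ} (u v : g → ℂ) (c : Fin p → g → ℂ)
    (X : Fin (p + 2) → g) :
    wedgeList (Fin.cons u (Fin.cons v c : Fin (p + 1) → g → ℂ) : Fin (p + 2) → g → ℂ) X =
      -wedgeList (Fin.cons v (Fin.cons u c : Fin (p + 1) → g → ℂ) : Fin (p + 2) → g → ℂ) X := by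
  simp only [wedgeList_cons_cons, ← Finset.sum_neg_distrib]
  refine Finset.sum_congr rfl fun i _ => Finset.sum_congr rfl fun j _ => ?_
  split_ifs
  · ring
  · simp

theorem wedgeList_cons_cons_cons_rotate {p : ℕ} (u v w : g → ℂ) (c : Fin p → g → ℂ)
    (X : Fin (p + 3) → g) :
    wedgeList (Fin.cons u (Fin.cons v (Fin.cons w c : Fin (p + 1) → g → ℂ) :
        Fin (p + 2) → g → ℂ) : Fin (p + 3) → g → ℂ) X =
      wedgeList (Fin.cons v (Fin.cons w (Fin.cons u c : Fin (p + 1) → g → ℂ) :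
        Fin (p + 2) → g → ℂ) : Fin (p + 3) → g → ℂ) X := by
  rw [wedgeList_cons_cons_swap, wedgeList_cons, wedgeList_cons v, ← Finset.sum_neg_distrib]
  refine Finset.sum_congr rfl fun i _ => ?_
  rw [wedgeList_cons_cons_swap u w]
  ring

theorem ceD_eq_sum_cons {p : ℕ} (η : (Fin (p + 1) → g) → ℂ) (X : Fin (p + 2) → g) :
    ceD η X = ∑ i : Fin (p + 2), ∑ j : Fin (p + 2), if (i : ℕ) < j then
      (-1) ^ ((i : ℕ) + j) * η (Fin.cons ⁅X i, X j⁆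
        (fun t : Fin p => X (skipTwo (N := p + 2) i j t)) : Fin (p + 1) → g) else 0 := by
  refine Finset.sum_congr rfl fun i _ => Finset.sum_congr rfl fun j _ => ?_
  split_ifs
  · congr 2
    funext t
    refine Fin.cases ?_ (fun t => ?_) t
    · simp
    · simp
  · rfl

/-- The wedge with a `1`-form on the left, in terms of the wedge of `1`-forms. -/
theorem wedge_oneF_wedgeList {p : ℕ} (u : g → ℂ) (c : Fin p → g → ℂ) :
    reind (Nat.add_comm 1 p) (wedge (oneF u) (wedgeList c)) =
      wedgeList (Fin.cons u c : Fin (p + 1) → g → ℂ) := by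
  funext X
  set P : Equiv.Perm (Fin p) → Equiv.Perm (Fin (p + 1)) :=
    fun τ => Equiv.Perm.decomposeFin.symm (0, τ)
  have key (σ : Equiv.Perm (Fin (p + 1))) : wedgeList c (fun t => X (σ t.succ)) =
      ∑ τ, ((Equiv.Perm.sign (P τ) : ℤ) : ℂ) * ∏ t, c t (X ((σ * P τ) t.succ)) := by
    simp [wedgeList, P]
  have hsum : ∑ σ : Equiv.Perm (Fin (p + 1)), ((Equiv.Perm.sign σ : ℤ) : ℂ) * u (X (σ 0)) *
      wedgeList c (fun t => X (σ t.succ)) =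
      (p.factorial : ℂ) * wedgeList (Fin.cons u c : Fin (p + 1) → g → ℂ) X := by
    simp only [key, Finset.mul_sum]
    rw [Finset.sum_comm]
    have : ∀ τ : Equiv.Perm (Fin p), ∑ σ : Equiv.Perm (Fin (p + 1)),
        ((Equiv.Perm.sign σ : ℤ) : ℂ) * u (X (σ 0)) *
          (((Equiv.Perm.sign (P τ) : ℤ) : ℂ) * ∏ t, c t (X ((σ * P τ) t.succ))) =
        wedgeList (Fin.cons u c : Fin (p + 1) → g → ℂ) X := by
      intro τ
      symm
      rw [wedgeList, ← Equiv.sum_comp (Equiv.mulRight (P τ))]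
      refine Finset.sum_congr rfl fun σ _ => ?_
      simp only [Fin.prod_univ_succ, Equiv.coe_mulRight, Equiv.Perm.sign_mul, Fin.cons_zero,
        Fin.cons_succ]
      have : (σ * P τ) 0 = σ 0 := by simp [P]
      rw [this]
      push_cast
      ring
    rw [Finset.sum_congr rfl fun τ _ => this τ]
    simp [Fintype.card_perm]
  have e : 1 + p = p + 1 := Nat.add_comm 1 p
  have hre : ∑ σ : Equiv.Perm (Fin (1 + p)), ((Equiv.Perm.sign σ : ℤ) : ℂ) *
      oneF u (fun i => X (Fin.cast e (σ (Fin.castAdd p i)))) *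
      wedgeList c (fun i => X (Fin.cast e (σ (Fin.natAdd 1 i)))) =
      ∑ σ : Equiv.Perm (Fin (p + 1)), ((Equiv.Perm.sign σ : ℤ) : ℂ) * u (X (σ 0)) *
      wedgeList c (fun t => X (σ t.succ)) := by
    rw [← Equiv.sum_comp (finCongr e).permCongr]
    refine Finset.sum_congr rfl fun σ _ => ?_
    have h0 : (finCongr e).symm 0 = Fin.castAdd p 0 := by ext; simp
    have hs (t : Fin p) : (finCongr e).symm t.succ = Fin.natAdd 1 t := by
      ext; simp [Nat.add_comm]
    simp only [Equiv.Perm.sign_permCongr, Equiv.permCongr_apply, h0, hs]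
    rfl
  have hp : (p.factorial : ℂ) ≠ 0 := by exact_mod_cast p.factorial_ne_zero
  simp only [reind, wedge]
  rw [hre, hsum]
  simp [hp]

theorem wedge_oneF_oneF (u v : g → ℂ) (X : Fin 2 → g) :
    wedge (oneF u) (oneF v) X = u (X 0) * v (X 1) - u (X 1) * v (X 0) := by
  have h := congrFun (wedge_oneF_wedgeList u (fun _ : Fin 1 => v)) X
  have h1 : wedgeList (fun _ : Fin 1 => v) = oneF v := by
    funext Y
    simp [wedgeList, oneF]
  rw [h1, wedgeList_eq_det, Matrix.det_fin_two] at h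
  refine Eq.trans h ?_
  simp [mul_comm]

end WedgeOfOneForms

section Interlace

variable {g : Type}

/-- The even index `2 t`. -/
def evenIdx {k : ℕ} (t : Fin k) : Fin (2 * k) := ⟨2 * (t : ℕ), by omega⟩

/-- The odd index `2 t + 1`. -/
def oddIdx {k : ℕ} (t : Fin k) : Fin (2 * k) := ⟨2 * (t : ℕ) + 1, by omega⟩

theorem evenIdx_injective {k : ℕ} : Function.Injective (evenIdx (k := k)) := by
  intro s t h
  simpa [evenIdx, Fin.ext_iff] using h

theorem oddIdx_injective {k : ℕ} : Function.Injective (oddIdx (k := k)) := by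
  intro s t h
  simpa [oddIdx, Fin.ext_iff] using h

theorem evenIdx_ne_oddIdx {k : ℕ} (s t : Fin k) : evenIdx s ≠ oddIdx t := by
  simp only [evenIdx, oddIdx, ne_eq, Fin.ext_iff]
  omega

/-- The sequence `a₀, b₀, a₁, b₁, …` of `1`-forms. -/
def interlace {k : ℕ} (a b : Fin k → g → ℂ) : Fin (2 * k) → g → ℂ :=
  fun s => if (s : ℕ) % 2 = 0 then a ⟨(s : ℕ) / 2, by omega⟩ else b ⟨(s : ℕ) / 2, by omega⟩

theorem interlace_evenIdx {k : ℕ} (a b : Fin k → g → ℂ) (t : Fin k) :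
    interlace a b (evenIdx t) = a t := by
  simp [interlace, evenIdx]

theorem interlace_oddIdx {k : ℕ} (a b : Fin k → g → ℂ) (t : Fin k) :
    interlace a b (oddIdx t) = b t := by
  have h : (2 * (t : ℕ) + 1) % 2 = 1 := by omega
  have h' : (2 * (t : ℕ) + 1) / 2 = t := by omega
  simp [interlace, oddIdx, h, h']

theorem exists_eq_evenIdx_or_oddIdx {k : ℕ} (s : Fin (2 * k)) :
    ∃ t : Fin k, s = evenIdx t ∨ s = oddIdx t := by
  refine ⟨⟨(s : ℕ) / 2, by omega⟩, ?_⟩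
  simp only [Fin.ext_iff, evenIdx, oddIdx]
  omega

theorem interlace_succ {k : ℕ} (a b : Fin (k + 1) → g → ℂ) :
    interlace a b = (Fin.cons (a 0) (Fin.cons (b 0)
      (interlace (a ∘ Fin.succ) (b ∘ Fin.succ)) : Fin (2 * k + 1) → g → ℂ) :
        Fin (2 * k + 2) → g → ℂ) := by
  funext s
  refine Fin.cases ?_ (fun s => Fin.cases ?_ (fun s => ?_) s) (s : Fin (2 * k + 2))
  · exact interlace_evenIdx a b 0
  · exact interlace_oddIdx a b 0
  · simp only [Fin.cons_succ, interlace, Fin.val_succ, Function.comp]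
    have h1 : ((s : ℕ) + 1 + 1) % 2 = (s : ℕ) % 2 := by omega
    have h2 : ((s : ℕ) + 1 + 1) / 2 = (s : ℕ) / 2 + 1 := by omega
    simp only [h1, h2]
    rfl

theorem prod_interlace {k : ℕ} (a b : Fin k → g → ℂ) (Y : Fin (2 * k) → g) :
    ∏ s, interlace a b s (Y s) = ∏ t : Fin k, a t (Y (evenIdx t)) * b t (Y (oddIdx t)) := by
  induction k with
  | zero => rfl
  | succ k ih =>
    rw [interlace_succ]
    change ∏ s : Fin (2 * k + 1 + 1), _ = _
    rw [Fin.prod_univ_succ, Fin.prod_univ_succ, Fin.prod_univ_succ]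
    simp only [Fin.cons_zero, Fin.cons_succ]
    rw [ih (a ∘ Fin.succ) (b ∘ Fin.succ) (fun s => Y s.succ.succ), mul_assoc]
    rfl

theorem interlace_comp_swap {k : ℕ} (a b : Fin k → g → ℂ) (i j : Fin k) :
    interlace (a ∘ Equiv.swap i j) (b ∘ Equiv.swap i j) = interlace a b ∘
      (Equiv.swap (evenIdx i) (evenIdx j) * Equiv.swap (oddIdx i) (oddIdx j) :
        Equiv.Perm (Fin (2 * k))) := by
  funext s
  obtain ⟨t, rfl | rfl⟩ := exists_eq_evenIdx_or_oddIdx s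
  · rw [Function.comp_apply, Equiv.Perm.mul_apply,
      Equiv.swap_apply_of_ne_of_ne (evenIdx_ne_oddIdx t i) (evenIdx_ne_oddIdx t j),
      evenIdx_injective.swap_apply, interlace_evenIdx, interlace_evenIdx]
    rfl
  · rw [Function.comp_apply, Equiv.Perm.mul_apply, oddIdx_injective.swap_apply,
      Equiv.swap_apply_of_ne_of_ne (evenIdx_ne_oddIdx i _).symm (evenIdx_ne_oddIdx j _).symm,
      interlace_oddIdx, interlace_oddIdx]
    rfl

variable [LieRing g] [LieAlgebra ℝ g]

theorem wedgeList_interlace_comp_swap {k : ℕ} (a b : Fin k → g → ℂ) (i j : Fin k)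
    (X : Fin (2 * k) → g) :
    wedgeList (interlace (a ∘ Equiv.swap i j) (b ∘ Equiv.swap i j)) X =
      wedgeList (interlace a b) X := by
  by_cases hij : i = j
  · subst hij
    simp
  · rw [interlace_comp_swap, wedgeList_comp_perm, Equiv.Perm.sign_mul,
      Equiv.Perm.sign_swap (evenIdx_injective.ne hij),
      Equiv.Perm.sign_swap (oddIdx_injective.ne hij)]
    simp

theorem wpow_eq_sum_wedgeList {C : Type*} [Fintype C] (a b : C → g → ℂ) (ω : (Fin 2 → g) → ℂ)
    (hω : ∀ v, ω v = ∑ c, a c (v 0) * b c (v 1)) (k : ℕ) (X : Fin (2 * k) → g) :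
    wpow ω k X = ((2 : ℂ) ^ k)⁻¹ *
      ∑ f : Fin k → C, wedgeList (interlace (a ∘ f) (b ∘ f)) X := by
  classical
  simp only [wpow, wedgeList]
  rw [Finset.sum_comm]
  congr 1
  refine Finset.sum_congr rfl fun σ _ => ?_
  rw [← Finset.mul_sum]
  congr 1
  simp only [hω, Finset.prod_univ_sum, Fintype.piFinset_univ]
  refine Finset.sum_congr rfl fun f _ => ?_
  rw [prod_interlace _ _ fun s => X (σ s)]
  rfl

/-- If a symmetric summand is supported on tuples in which exactly one entry satisfies `P`,
we may assume that this entry comes first. -/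
theorem sum_tuple_of_existsUnique {C : Type*} [Fintype C] {m : ℕ} (P : C → Prop)
    [DecidablePred P] (T : (Fin (m + 1) → C) → ℂ)
    (hsymm : ∀ f t, T (f ∘ Equiv.swap 0 t) = T f)
    (huniq : ∀ f, T f ≠ 0 → ∃! t, P (f t)) :
    ∑ f, T f = (m + 1) * ∑ c, if P c then ∑ f : Fin m → C, T (Fin.cons c f : Fin (m + 1) → C)
      else 0 := by
  classical
  have h1 (f : Fin (m + 1) → C) : T f = ∑ t, if P (f t) then T f else 0 := by
    by_cases hf : T f = 0
    · simp [hf]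
    · obtain ⟨t, ht, htu⟩ := huniq f hf
      rw [Finset.sum_eq_single t (fun s _ hs => if_neg fun h => hs (htu s h)) (by simp)]
      simp [ht]
  have h2 (t : Fin (m + 1)) : ∑ f, (if P (f t) then T f else 0) =
      ∑ f, if P (f 0) then T f else 0 := by
    rw [← Equiv.sum_comp (Equiv.arrowCongr (Equiv.swap 0 t) (Equiv.refl C))]
    refine Finset.sum_congr rfl fun f _ => ?_
    have : (Equiv.arrowCongr (Equiv.swap 0 t) (Equiv.refl C)) f = f ∘ Equiv.swap 0 t := by
      funext s
      simp [Equiv.arrowCongr]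
    rw [this, hsymm]
    simp
  calc ∑ f, T f = ∑ f, ∑ t, if P (f t) then T f else 0 := Finset.sum_congr rfl fun f _ => h1 f
    _ = ∑ t : Fin (m + 1), ∑ f, if P (f 0) then T f else 0 := by
      rw [Finset.sum_comm]
      exact Finset.sum_congr rfl fun t _ => h2 t
    _ = _ := by
      rw [Finset.sum_const, Finset.card_univ, Fintype.card_fin, nsmul_eq_mul,
        ← Equiv.sum_comp (Fin.consEquiv fun _ : Fin (m + 1) => C), Fintype.sum_prod_type]
      push_cast
      congr 1
      refine Finset.sum_congr rfl fun c _ => ?_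
      split_ifs with h <;> simp [Fin.consEquiv, h]

end Interlace

section HermitianForm

variable {g : Type} [LieRing g] [LieAlgebra ℝ g]

open Complex ComplexConjugate

/-- The first factors in the expansion of `i Σ α_j ∧ ᾱ_j` as a sum of tensor products:
`i α_j` and `-i ᾱ_j`. -/
noncomputable def fstFactor {n : ℕ} (α : Fin n → (g →ₗ[ℝ] ℂ)) : Fin n × Bool → g → ℂ
  | (j, true) => fun x => I * α j x
  | (j, false) => fun x => -I * conj (α j x)

/-- The second factors in the expansion of `i Σ α_j ∧ ᾱ_j` as a sum of tensor products:
`ᾱ_j` and `α_j`. -/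
noncomputable def sndFactor {n : ℕ} (α : Fin n → (g →ₗ[ℝ] ℂ)) : Fin n × Bool → g → ℂ
  | (j, true) => fun x => conj (α j x)
  | (j, false) => fun x => α j x

/-- The wedge of the factors of the terms selected by `f`. -/
noncomputable def factorForm {n k : ℕ} (α : Fin n → (g →ₗ[ℝ] ℂ)) (f : Fin k → Fin n × Bool) :
    Fin (2 * k) → g → ℂ :=
  interlace (fstFactor α ∘ f) (sndFactor α ∘ f)

theorem factorForm_cons {n k : ℕ} (α : Fin n → (g →ₗ[ℝ] ℂ)) (c : Fin n × Bool)
    (f : Fin k → Fin n × Bool) :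
    factorForm α (Fin.cons c f : Fin (k + 1) → Fin n × Bool) =
      (Fin.cons (fstFactor α c) (Fin.cons (sndFactor α c) (factorForm α f) :
        Fin (2 * k + 1) → g → ℂ) : Fin (2 * k + 2) → g → ℂ) := by
  rw [factorForm, interlace_succ]
  rfl

theorem wedgeList_factorForm_eq_zero {n k : ℕ} (α : Fin n → (g →ₗ[ℝ] ℂ))
    (f : Fin k → Fin n × Bool) {s t : Fin k} (hst : s ≠ t) (h : (f s).1 = (f t).1)
    (X : Fin (2 * k) → g) : wedgeList (factorForm α f) X = 0 := by
  rcases hs : f s with ⟨i, _ | _⟩ <;> rcases ht : f t with ⟨j, _ | _⟩ <;>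
    obtain rfl : i = j := by simpa [hs, ht] using h
  · refine wedgeList_eq_zero_of_eq_smul _ (evenIdx_injective.ne hst) 1 (fun x => ?_) X
    simp [factorForm, interlace_evenIdx, hs, ht]
  · refine wedgeList_eq_zero_of_eq_smul _ (evenIdx_ne_oddIdx s t) (-I) (fun x => ?_) X
    simp [factorForm, interlace_evenIdx, interlace_oddIdx, fstFactor, sndFactor, hs, ht]
  · refine wedgeList_eq_zero_of_eq_smul _ (evenIdx_ne_oddIdx s t) I (fun x => ?_) X
    simp [factorForm, interlace_evenIdx, interlace_oddIdx, fstFactor, sndFactor, hs, ht]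
  · refine wedgeList_eq_zero_of_eq_smul _ (evenIdx_injective.ne hst) 1 (fun x => ?_) X
    simp [factorForm, interlace_evenIdx, hs, ht]

theorem wedgeList_factorForm_comp_swap {n k : ℕ} (α : Fin n → (g →ₗ[ℝ] ℂ))
    (f : Fin k → Fin n × Bool) (s t : Fin k) (X : Fin (2 * k) → g) :
    wedgeList (factorForm α (f ∘ Equiv.swap s t)) X = wedgeList (factorForm α f) X :=
  wedgeList_interlace_comp_swap (fstFactor α ∘ f) (sndFactor α ∘ f) s t X

theorem wedgeList_cons_real_factorForm_eq_zero {n k : ℕ} (α : Fin n → (g →ₗ[ℝ] ℂ))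
    (q : ℂ) (f : Fin k → Fin n × Bool) (t : Fin k) (X : Fin (2 * k + 1) → g) :
    wedgeList (Fin.cons (fun x => q * (α (f t).1 x + conj (α (f t).1 x))) (factorForm α f) :
      Fin (2 * k + 1) → g → ℂ) X = 0 := by
  have h : (fun x => q * (α (f t).1 x + conj (α (f t).1 x))) =
      if (f t).2 then fun x => q * -I * fstFactor α (f t) x + q * sndFactor α (f t) x
      else fun x => q * I * fstFactor α (f t) x + q * sndFactor α (f t) x := by
    rcases f t with ⟨j, _ | _⟩ <;> funext x <;>
      simp only [fstFactor, sndFactor, if_true, if_false, Bool.false_eq_true]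
    · linear_combination (-q * conj (α j x)) * (-I_mul_I)
    · linear_combination (-q * α j x) * (-I_mul_I)
  have h1 : wedgeList (Fin.cons (fstFactor α (f t)) (factorForm α f) :
      Fin (2 * k + 1) → g → ℂ) X = 0 :=
    wedgeList_eq_zero_of_eq_smul _ (Fin.succ_ne_zero (evenIdx t)).symm 1
      (fun x => by simp [factorForm, interlace_evenIdx]) X
  have h2 : wedgeList (Fin.cons (sndFactor α (f t)) (factorForm α f) :
      Fin (2 * k + 1) → g → ℂ) X = 0 :=
    wedgeList_eq_zero_of_eq_smul _ (Fin.succ_ne_zero (oddIdx t)).symm 1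
      (fun x => by simp [factorForm, interlace_oddIdx]) X
  rw [h]
  split_ifs <;> rw [wedgeList_cons_add_smul, h1, h2] <;> simp

theorem wedgeList_eq_zero_of_apply_eq_zero {p : ℕ} (c : Fin p → g → ℂ) (X : Fin p → g)
    (i : Fin p) (h : ∀ t, c t (X i) = 0) : wedgeList c X = 0 := by
  rw [wedgeList_eq_det]
  exact Matrix.det_eq_zero_of_row_eq_zero i h

theorem sum_wedgeList_cons_factorForm {m : ℕ} (α : Fin (m + 2) → (g →ₗ[ℝ] ℂ)) (q : ℂ)
    (θ : g → ℂ) (hθ : θ = fun x => q * (α (Fin.last (m + 1)) x + conj (α (Fin.last (m + 1)) x)))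
    (X : Fin (2 * (m + 1) + 1) → g) :
    ∑ f : Fin (m + 1) → Fin (m + 2) × Bool,
      wedgeList (Fin.cons θ (factorForm α f) : Fin (2 * (m + 1) + 1) → g → ℂ) X =
    (m + 1) * (2 * I * ∑ f : Fin m → Fin (m + 2) × Bool,
      wedgeList (Fin.cons (fun x => α 0 x) (Fin.cons (fun x => conj (α 0 x))
        (Fin.cons θ (factorForm α f) : Fin (2 * m + 1) → g → ℂ) : Fin (2 * m + 2) → g → ℂ) :
          Fin (2 * m + 3) → g → ℂ) X) := by
  rw [sum_tuple_of_existsUnique (fun c => c.1 = 0)]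
  · congr 1
    rw [Fintype.sum_prod_type, Finset.sum_eq_single 0 (by simp +contextual) (by simp)]
    rw [Fintype.sum_bool, if_pos rfl, if_pos rfl, ← Finset.sum_add_distrib, Finset.mul_sum]
    refine Finset.sum_congr rfl fun f _ => ?_
    rw [factorForm_cons, factorForm_cons]
    have e (u v : g → ℂ) :
        wedgeList (Fin.cons θ (Fin.cons u (Fin.cons v (factorForm α f) :
          Fin (2 * m + 1) → g → ℂ) : Fin (2 * m + 2) → g → ℂ) : Fin (2 * m + 3) → g → ℂ) X =
        wedgeList (Fin.cons u (Fin.cons v (Fin.cons θ (factorForm α f) :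
          Fin (2 * m + 1) → g → ℂ) : Fin (2 * m + 2) → g → ℂ) : Fin (2 * m + 3) → g → ℂ) X :=
      wedgeList_cons_cons_cons_rotate _ _ _ _ _
    refine (congrArg₂ (· + ·) (e _ _) (e _ _)).trans ?_
    simp only [fstFactor, sndFactor]
    rw [wedgeList_cons_smul, wedgeList_cons_smul,
      wedgeList_cons_cons_swap (fun x => conj (α 0 x))]
    ring
  · intro f t
    simp only [wedgeList_cons, wedgeList_factorForm_comp_swap]
  · intro f hf
    have hlast (t : Fin (m + 1)) : (f t).1 ≠ Fin.last (m + 1) := by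
      intro ht
      refine hf ?_
      rw [hθ, ← ht]
      exact wedgeList_cons_real_factorForm_eq_zero α q f t X
    have hinj : Function.Injective fun t => (f t).1.castPred (hlast t) := by
      intro s t hst
      by_contra hne
      refine hf ?_
      rw [wedgeList_cons]
      refine Finset.sum_eq_zero fun i _ => ?_
      rw [wedgeList_factorForm_eq_zero α f hne (by simpa using hst), mul_zero]
    obtain ⟨t, ht⟩ := (Finite.injective_iff_surjective.1 hinj) 0
    have ht' : (f t).1 = 0 := by
      have := congrArg Fin.castSucc ht
      simpa using this
    exact ⟨t, ht', fun s hs => hinj (by simp [hs, ht'])⟩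

theorem sum_wedgeList_factorForm_cons {m : ℕ} (α : Fin (m + 2) → (g →ₗ[ℝ] ℂ)) (q w : ℂ)
    (θ : g → ℂ) (hθ : θ = fun x => q * (α (Fin.last (m + 1)) x + conj (α (Fin.last (m + 1)) x)))
    (z : g) (hz : ∀ j, j ≠ Fin.last (m + 1) → α j z = 0)
    (hzl : α (Fin.last (m + 1)) z = -(q * w)) (hzc : conj (α (Fin.last (m + 1)) z) = q * w)
    (Y : Fin (2 * m + 1) → g) :
    ∑ f : Fin (m + 1) → Fin (m + 2) × Bool,
      wedgeList (factorForm α f) (Fin.cons z Y : Fin (2 * m + 2) → g) =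
    (m + 1) * (2 * (-I * w) * ∑ f : Fin m → Fin (m + 2) × Bool,
      wedgeList (Fin.cons θ (factorForm α f) : Fin (2 * m + 1) → g → ℂ) Y) := by
  have hvanish {k : ℕ} (f : Fin k → Fin (m + 2) × Bool)
      (hf : ∀ t, (f t).1 ≠ Fin.last (m + 1)) (s : Fin (2 * k)) : factorForm α f s z = 0 := by
    obtain ⟨t, rfl | rfl⟩ := exists_eq_evenIdx_or_oddIdx s
    · rw [factorForm, interlace_evenIdx, Function.comp_apply]
      have := hz _ (hf t)
      rcases hft : f t with ⟨j, _ | _⟩ <;> simp only [hft] at this <;> simp [fstFactor, this]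
    · rw [factorForm, interlace_oddIdx, Function.comp_apply]
      have := hz _ (hf t)
      rcases hft : f t with ⟨j, _ | _⟩ <;> simp only [hft] at this <;> simp [sndFactor, this]
  rw [sum_tuple_of_existsUnique (fun c => c.1 = Fin.last (m + 1))]
  · congr 1
    rw [Fintype.sum_prod_type, Finset.sum_eq_single (Fin.last (m + 1)) (by simp +contextual)
      (by simp)]
    rw [Fintype.sum_bool, if_pos rfl, if_pos rfl, ← Finset.sum_add_distrib, Finset.mul_sum]
    refine Finset.sum_congr rfl fun f _ => ?_
    by_cases hf : ∃ t, (f t).1 = Fin.last (m + 1)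
    · obtain ⟨t, ht⟩ := hf
      rw [wedgeList_factorForm_eq_zero α _ (Fin.succ_ne_zero t) (by simp [ht]),
        wedgeList_factorForm_eq_zero α _ (Fin.succ_ne_zero t) (by simp [ht]), hθ, ← ht,
        wedgeList_cons_real_factorForm_eq_zero]
      simp
    · push Not at hf
      rw [factorForm_cons, factorForm_cons]
      refine (congrArg₂ (· + ·)
        (wedgeList_cons_cons_apply_cons _ _ _ z (hvanish f hf) Y)
        (wedgeList_cons_cons_apply_cons _ _ _ z (hvanish f hf) Y)).trans ?_
      have hθ' : θ = fun x => q * α (Fin.last (m + 1)) x + q * conj (α (Fin.last (m + 1)) x) := by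
        rw [hθ]
        funext x
        ring
      simp only [fstFactor, sndFactor, hzc]
      rw [hzl]
      rw [hθ', wedgeList_cons_add_smul, wedgeList_cons_smul, wedgeList_cons_smul]
      ring
  · intro f t
    rw [wedgeList_factorForm_comp_swap]
  · intro f hf
    have hinj {s t : Fin (m + 1)} (hst : (f s).1 = (f t).1) : s = t := by
      by_contra hne
      exact hf (wedgeList_factorForm_eq_zero α f hne hst _)
    obtain ⟨t, ht⟩ : ∃ t, (f t).1 = Fin.last (m + 1) := by
      by_contra! hne
      exact hf (wedgeList_eq_zero_of_apply_eq_zero _ _ 0 (hvanish f hne))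
    exact ⟨t, ht, fun s hs => hinj (hs.trans ht.symm)⟩

theorem ceD_wpow_eq_wedge {m : ℕ} (α : Fin (m + 2) → (g →ₗ[ℝ] ℂ)) (q : ℝ)
    (hbr : ∀ j, j ≠ Fin.last (m + 1) → ∀ x y : g, α j ⁅x, y⁆ = 0)
    (hlast : ∀ x y : g, α (Fin.last (m + 1)) ⁅x, y⁆ =
      -(q * (α 0 x * conj (α 0 y) - α 0 y * conj (α 0 x))))
    (ω : (Fin 2 → g) → ℂ)
    (hω : ∀ v, ω v = I * ∑ j, (α j (v 0) * conj (α j (v 1)) - α j (v 1) * conj (α j (v 0)))) :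
    ceD (wpow ω (m + 1)) = reind (Nat.add_comm 1 _) (wedge (oneF fun x =>
      (q : ℂ) * (α (Fin.last (m + 1)) x + conj (α (Fin.last (m + 1)) x))) (wpow ω (m + 1))) := by
  have hω' (v : Fin 2 → g) : ω v = ∑ c, fstFactor α c (v 0) * sndFactor α c (v 1) := by
    rw [hω, Fintype.sum_prod_type, Finset.mul_sum]
    refine Finset.sum_congr rfl fun j _ => ?_
    simp only [Fintype.sum_bool, fstFactor, sndFactor]
    ring
  have hpow : wpow ω (m + 1) = fun X => ((2 : ℂ) ^ (m + 1))⁻¹ *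
      ∑ f : Fin (m + 1) → Fin (m + 2) × Bool, wedgeList (factorForm α f) X :=
    funext fun X => wpow_eq_sum_wedgeList _ _ ω hω' (m + 1) X
  set θ : g → ℂ := fun x =>
    (q : ℂ) * (α (Fin.last (m + 1)) x + conj (α (Fin.last (m + 1)) x)) with hθ
  have hwedge (X : Fin (2 * (m + 1) + 1) → g) :
      reind (Nat.add_comm 1 _) (wedge (oneF θ) (wpow ω (m + 1))) X =
      ((2 : ℂ) ^ (m + 1))⁻¹ * ∑ f : Fin (m + 1) → Fin (m + 2) × Bool,
        wedgeList (Fin.cons θ (factorForm α f) : Fin (2 * (m + 1) + 1) → g → ℂ) X := by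
    simp only [← wedge_oneF_wedgeList]
    rw [hpow]
    simp only [reind, wedge, Finset.mul_sum]
    rw [Finset.sum_comm]
    exact Finset.sum_congr rfl fun f _ => Finset.sum_congr rfl fun σ _ => by ring
  funext X
  rw [hwedge, sum_wedgeList_cons_factorForm α q θ hθ]
  refine (ceD_eq_sum_cons (p := 2 * m + 1) (wpow ω (m + 1)) X).trans ?_
  have hterm (x y : g) (Y : Fin (2 * m + 1) → g) :
      wpow ω (m + 1) (Fin.cons ⁅x, y⁆ Y : Fin (2 * m + 2) → g) =
      ((2 : ℂ) ^ (m + 1))⁻¹ * ((m + 1) * (2 * (-I * (α 0 x * conj (α 0 y) -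
        α 0 y * conj (α 0 x))) * ∑ f : Fin m → Fin (m + 2) × Bool,
          wedgeList (Fin.cons θ (factorForm α f) : Fin (2 * m + 1) → g → ℂ) Y)) := by
    rw [hpow, ← sum_wedgeList_factorForm_cons α q _ θ hθ ⁅x, y⁆ (fun j hj => hbr j hj x y)
      (hlast x y)]
    rw [hlast]
    simp only [map_neg, map_mul, map_sub, conj_ofReal, conj_conj]
    ring
  have hexpand : ∑ f : Fin m → Fin (m + 2) × Bool,
      wedgeList (Fin.cons (fun x => α 0 x) (Fin.cons (fun x => conj (α 0 x))
        (Fin.cons θ (factorForm α f) : Fin (2 * m + 1) → g → ℂ) : Fin (2 * m + 2) → g → ℂ) :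
          Fin (2 * m + 3) → g → ℂ) X =
      ∑ i : Fin (2 * m + 3), ∑ j : Fin (2 * m + 3), if (i : ℕ) < j then
        (-1) ^ ((i : ℕ) + j) * (-(α 0 (X i) * conj (α 0 (X j)) - α 0 (X j) * conj (α 0 (X i)))) *
          ∑ f : Fin m → Fin (m + 2) × Bool,
            wedgeList (Fin.cons θ (factorForm α f) : Fin (2 * m + 1) → g → ℂ)
              (fun t : Fin (2 * m + 1) => X (skipTwo (N := 2 * m + 3) i j t)) else 0 := by
    rw [Finset.sum_congr rfl fun f _ => wedgeList_cons_cons (p := 2 * m + 1) _ _ _ X,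
      Finset.sum_comm]
    refine Finset.sum_congr rfl fun i _ => ?_
    rw [Finset.sum_comm]
    refine Finset.sum_congr rfl fun j _ => ?_
    split_ifs
    · rw [Finset.mul_sum]
    · simp
  rw [hexpand]
  simp only [hterm, Finset.mul_sum (s := (Finset.univ : Finset (Fin (2 * m + 3))))]
  refine Finset.sum_congr rfl fun i _ => Finset.sum_congr rfl fun j _ => ?_
  split_ifs
  · ring
  · simp

end HermitianForm

section LowDegree

open Complex ComplexConjugate

variable {g : Type}

theorem cons_skipTwo_one (X : Fin 3 → g) (z : g) (i j : ℕ) :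
    (Fin.cons z fun t : Fin 1 => X (skipTwo (N := 3) i j t) : Fin 2 → g) =
      ![z, X (skipTwo (N := 3) i j 0)] := by
  funext t; fin_cases t <;> rfl

theorem cons_skipTwo_two (X : Fin 4 → g) (z : g) (i j : ℕ) :
    (Fin.cons z fun t : Fin 2 => X (skipTwo (N := 4) i j t) : Fin 3 → g) =
      ![z, X (skipTwo (N := 4) i j 0), X (skipTwo (N := 4) i j 1)] := by
  funext t; fin_cases t <;> rfl

variable [LieRing g] [LieAlgebra ℝ g]

theorem ceD_one_apply (η : (Fin 1 → g) → ℂ) (X : Fin 2 → g) :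
    ceD η X = -η ![⁅X 0, X 1⁆] := by
  have e : (Fin.cons ⁅X 0, X 1⁆ fun t : Fin 0 => X (skipTwo (N := 2) 0 1 t) : Fin 1 → g) =
      ![⁅X 0, X 1⁆] := by
    funext t; fin_cases t; rfl
  rw [ceD_eq_sum_cons (p := 0)]
  simp [Fin.sum_univ_two, e]

theorem ceD_two_apply (η : (Fin 2 → g) → ℂ) (X : Fin 3 → g) :
    ceD η X = -η ![⁅X 0, X 1⁆, X 2] + η ![⁅X 0, X 2⁆, X 1] - η ![⁅X 1, X 2⁆, X 0] := by
  rw [ceD_eq_sum_cons (p := 1)]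
  simp only [cons_skipTwo_one]
  simp [Fin.sum_univ_three, skipTwo]
  ring

theorem ceD_three_apply (η : (Fin 3 → g) → ℂ) (X : Fin 4 → g) :
    ceD η X = -η ![⁅X 0, X 1⁆, X 2, X 3] + η ![⁅X 0, X 2⁆, X 1, X 3]
      - η ![⁅X 0, X 3⁆, X 1, X 2] - η ![⁅X 1, X 2⁆, X 0, X 3]
      + η ![⁅X 1, X 3⁆, X 0, X 2] - η ![⁅X 2, X 3⁆, X 0, X 1] := by
  rw [ceD_eq_sum_cons (p := 2)]
  simp only [cons_skipTwo_two]
  simp [Fin.sum_univ_four, skipTwo]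
  ring

theorem ceD_dcD_eq_zero (J : g →ₗ[ℝ] g) (q : ℂ) (a φ : g → ℂ) (ω : (Fin 2 → g) → ℂ)
    (hJω : ∀ v : Fin 2 → g, ω (fun i => J (v i)) = ω v)
    (haJ : ∀ x, a (J x) = I * a x) (hφJ : ∀ x, φ (J x) = I * φ x)
    (ha : ∀ x y : g, a ⁅x, y⁆ = 0)
    (hφ : ∀ x y : g, φ ⁅x, y⁆ = -(q * (a x * conj (a y) - a y * conj (a x))))
    (hφc : ∀ x y : g, conj (φ ⁅x, y⁆) = q * (a x * conj (a y) - a y * conj (a x)))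
    (hω : ∀ x y z : g, ω ![⁅x, y⁆, z] =
      -I * (a x * conj (a y) - a y * conj (a x)) * (q * (φ z + conj (φ z)))) :
    ceD (dcD J ω) = 0 := by
  have hJ : Jact J ω = ω := by
    funext v
    simp [Jact, hJω]
  have hdc (x y z : g) : dcD J ω ![x, y, z] =
      q * ((a x * conj (a y) - a y * conj (a x)) * (φ z - conj (φ z))
        - (a x * conj (a z) - a z * conj (a x)) * (φ y - conj (φ y))
        + (a y * conj (a z) - a z * conj (a y)) * (φ x - conj (φ x))) := by
    simp only [dcD, hJ]
    rw [Jact, ceD_two_apply]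
    simp only [hω, Matrix.cons_val, haJ, hφJ, map_mul, conj_I]
    ring_nf
    simp only [show I ^ 4 = 1 from I_pow_four]
    ring
  funext X
  rw [ceD_three_apply]
  simp only [hdc, ha, hφc, map_zero, Pi.zero_apply]
  simp only [hφ]
  ring

end LowDegree

/-- Let `n ≥ 2`, `q ≠ 0` real, and `𝔤` a `2n`-dimensional real Lie algebra
with complex structure `J` admitting a basis `α₁,…,α_n` of `(𝔤^{1,0})*` with `dα_k = 0` for
`k ≤ n−1` and `dα_n = q α₁ ∧ ᾱ₁`.  Then the positive `(1,1)`-form `ω = i Σ α_j ∧ ᾱ_j` is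
pluriclosed (`ddᶜω = 0`) and locally conformally balanced: `d(ω^{n−1}) = θ ∧ ω^{n−1}` with
`θ = q(α_n + ᾱ_n)` closed. -/
theorem statement16 (n : ℕ) (hn : 2 ≤ n) (q : ℝ) (hq : q ≠ 0)
    (g : Type) [LieRing g] [LieAlgebra ℝ g]
    (J : g →ₗ[ℝ] g)
    (hJ2 : ∀ x, J (J x) = -x)
    (hJi : ∀ x y : g, J ⁅x, y⁆ - ⁅J x, y⁆ - ⁅x, J y⁆ - J ⁅J x, J y⁆ = 0)
    (α : Fin n → (g →ₗ[ℝ] ℂ))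
    (hα10 : ∀ i x, α i (J x) = Complex.I * α i x)
    (hbasis : Function.Bijective (fun (x : g) (i : Fin n) => α i x))
    (hd1 : ∀ i : Fin n, (i : ℕ) < n - 1 → ceD (oneF fun x => α i x) = 0)
    (hd2 : ceD (oneF fun x => α ⟨n - 1, by omega⟩ x) =
      fun v => (q : ℂ) * wedge (oneF fun x => α ⟨0, by omega⟩ x)
        (oneF fun x => (starRingEnd ℂ) (α ⟨0, by omega⟩ x)) v)
    (ω : (Fin 2 → g) → ℂ)
    (hω : ω = fun v => Complex.I * ∑ j : Fin n,
      wedge (oneF fun x => α j x) (oneF fun x => (starRingEnd ℂ) (α j x)) v)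
    (θ : (Fin 1 → g) → ℂ)
    (hθ : θ = oneF fun x =>
      (q : ℂ) * (α ⟨n - 1, by omega⟩ x + (starRingEnd ℂ) (α ⟨n - 1, by omega⟩ x))) :
    (∀ v, (ω v).im = 0) ∧
    (∀ v : Fin 2 → g, ω (fun i => J (v i)) = ω v) ∧
    (∀ x : g, x ≠ 0 → 0 < (ω ![x, J x]).re) ∧
    ceD (dcD J ω) = 0 ∧
    ceD (wpow ω (n - 1)) = reind (by omega) (wedge θ (wpow ω (n - 1))) ∧
    ceD θ = 0 := by
  obtain ⟨m, rfl⟩ : ∃ m, n = m + 2 := ⟨n - 2, by omega⟩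
  have hbr (j : Fin (m + 2)) (hj : j ≠ Fin.last (m + 1)) (x y : g) : α j ⁅x, y⁆ = 0 := by
    have h := congrFun (hd1 j (by simp only [ne_eq, Fin.ext_iff, Fin.val_last] at hj; omega)) ![x, y]
    rw [ceD_one_apply] at h
    simpa [oneF] using h
  have hlast (x y : g) : α (Fin.last (m + 1)) ⁅x, y⁆ =
      -(q * (α 0 x * (starRingEnd ℂ) (α 0 y) - α 0 y * (starRingEnd ℂ) (α 0 x))) := by
    have h := congrFun hd2 ![x, y]
    rw [ceD_one_apply] at h
    rw [← neg_eq_iff_eq_neg]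
    refine Eq.trans h ?_
    rw [wedge_oneF_oneF]
    rfl
  have hconj (x y : g) : (starRingEnd ℂ) (α (Fin.last (m + 1)) ⁅x, y⁆) =
      q * (α 0 x * (starRingEnd ℂ) (α 0 y) - α 0 y * (starRingEnd ℂ) (α 0 x)) := by
    rw [hlast]
    simp only [map_neg, map_mul, map_sub, Complex.conj_ofReal, Complex.conj_conj]
    ring
  have hω' (v : Fin 2 → g) : ω v = Complex.I * ∑ j, (α j (v 0) * (starRingEnd ℂ) (α j (v 1)) -
      α j (v 1) * (starRingEnd ℂ) (α j (v 0))) := by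
    simp only [hω, wedge_oneF_oneF]
  have hJω (v : Fin 2 → g) : ω (fun i => J (v i)) = ω v := by
    rw [hω', hω']
    congr 1
    refine Finset.sum_congr rfl fun j _ => ?_
    simp only [hα10, map_mul, Complex.conj_I]
    linear_combination (-(α j (v 0) * (starRingEnd ℂ) (α j (v 1)) -
      α j (v 1) * (starRingEnd ℂ) (α j (v 0)))) * Complex.I_mul_I
  refine ⟨fun v => ?_, hJω, fun x hx => ?_, ?_, ?_, ?_⟩
  · rw [← Complex.conj_eq_iff_im, hω']
    simp only [map_mul, map_sum, map_sub, Complex.conj_I, Complex.conj_conj, Finset.mul_sum]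
    exact Finset.sum_congr rfl fun j _ => by ring
  · have h : ω ![x, J x] = ((2 * ∑ j, Complex.normSq (α j x) : ℝ) : ℂ) := by
      rw [hω']
      push_cast
      simp only [Finset.mul_sum]
      refine Finset.sum_congr rfl fun j _ => ?_
      simp only [Complex.normSq_eq_conj_mul_self, hα10, map_mul, Complex.conj_I]
      linear_combination (-2 * α j x * (starRingEnd ℂ) (α j x)) * Complex.I_mul_I
    rw [h, Complex.ofReal_re]
    obtain ⟨j, hj⟩ : ∃ j, α j x ≠ 0 := by
      by_contra! hne
      exact hx (hbasis.1 (funext fun j => by simp [hne j]))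
    have := Finset.sum_pos' (s := Finset.univ) (fun j _ => Complex.normSq_nonneg (α j x))
      ⟨j, Finset.mem_univ j, Complex.normSq_pos.2 hj⟩
    linarith
  · have h0 : (0 : Fin (m + 2)) ≠ Fin.last (m + 1) := (Fin.last_pos).ne
    refine ceD_dcD_eq_zero J q (α 0) (α (Fin.last (m + 1))) ω hJω (hα10 _) (hα10 _)
      (hbr 0 h0) hlast hconj fun x y z => ?_
    rw [hω', Finset.sum_eq_single (Fin.last (m + 1))
      (fun j _ hj => by simp [hbr j hj]) (by simp)]
    simp only [Matrix.cons_val, hconj]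
    rw [hlast]
    ring
  · rw [hθ]
    exact ceD_wpow_eq_wedge α q hbr hlast ω hω'
  · funext X
    rw [ceD_one_apply, hθ]
    have h : α (Fin.last (m + 1)) ⁅X 0, X 1⁆ +
        (starRingEnd ℂ) (α (Fin.last (m + 1)) ⁅X 0, X 1⁆) = 0 := by
      rw [hconj, hlast]
      ring
    exact neg_eq_zero.2 (mul_eq_zero_of_right _ h)
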